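/- (Proposition: local energy decay.) Assume (A.1), (A.2), (V.1), (V.2), let C* > 0 be a constant for which the Poincaré-type inequality ∫_{|x|≤L} w² ≤ C*(∫_ℝ (w')² + ∫_{|x|≥L} w²) holds on H¹(ℝ), and suppose 0 < V(0) < 1/(4C*). Then there exists C > 0 such that for every smooth classical solution u of u_tt − u_xx + V(x)u + a(x)u_t = 0 with smooth compactly supported initial data (u₀,u₁) and all t ≥ 0: (1+t) ∫_{|x| ≤ L} u(t,x)² dx ≤ C I₀², where I₀ := ‖u₀‖_{H¹} + ‖u₁‖_{L²} + ‖(u₁ + a·u₀)/√V‖_{L²}. -/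

import Mathlib

open MeasureTheory

noncomputable def ut (u : ℝ → ℝ → ℝ) (t x : ℝ) : ℝ := deriv (fun s => u s x) t

noncomputable def ux (u : ℝ → ℝ → ℝ) (t x : ℝ) : ℝ := deriv (fun y => u t y) x

noncomputable def utt (u : ℝ → ℝ → ℝ) (t x : ℝ) : ℝ := deriv (fun s => ut u s x) t

noncomputable def uxx (u : ℝ → ℝ → ℝ) (t x : ℝ) : ℝ := deriv (fun y => ux u t y) x

noncomputable def Eu (V : ℝ → ℝ) (u : ℝ → ℝ → ℝ) (t : ℝ) : ℝ :=
  (1/2) * ((∫ x, (ut u t x)^2) + (∫ x, (ux u t x)^2) + ∫ x, V x * (u t x)^2)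

/-- `u` is a smooth classical solution of `u_tt - u_xx + V u + a u_t = 0` with smooth
compactly supported initial data `(u₀, u₁)`, vanishing for large `|x|` on each `[0,T]`. -/
def IsSmoothSolution (V a : ℝ → ℝ) (u : ℝ → ℝ → ℝ) (u₀ u₁ : ℝ → ℝ) : Prop :=
  ContDiff ℝ (⊤ : ℕ∞) (fun p : ℝ × ℝ => u p.1 p.2) ∧
  (∀ t > (0:ℝ), ∀ x : ℝ, utt u t x - uxx u t x + V x * u t x + a x * ut u t x = 0) ∧
  (∀ x : ℝ, u 0 x = u₀ x) ∧ (∀ x : ℝ, ut u 0 x = u₁ x) ∧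
  ContDiff ℝ (⊤ : ℕ∞) u₀ ∧ HasCompactSupport u₀ ∧
  ContDiff ℝ (⊤ : ℕ∞) u₁ ∧ HasCompactSupport u₁ ∧
  (∀ T > (0:ℝ), ∃ R > (0:ℝ), ∀ t ∈ Set.Icc (0:ℝ) T, ∀ x : ℝ, R ≤ |x| → u t x = 0)

/-- The quantity `I₀ = ‖u₀‖_{H¹} + ‖u₁‖_{L²} + ‖(u₁ + a u₀)/√V‖_{L²}`. -/
noncomputable def I0 (a V u₀ u₁ : ℝ → ℝ) : ℝ :=
  Real.sqrt ((∫ x, u₀ x ^ 2) + ∫ x, (deriv u₀ x) ^ 2)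
    + Real.sqrt (∫ x, u₁ x ^ 2)
    + Real.sqrt (∫ x, (u₁ x + a x * u₀ x) ^ 2 / V x)


/-- Analytic package extracted from a smooth solution on `[0,T]`. -/
structure SolData (V a : ℝ → ℝ) (u p q m s r : ℝ → ℝ → ℝ) (T R : ℝ) : Prop where
  cu : Continuous (Function.uncurry u)
  cp : Continuous (Function.uncurry p)
  cq : Continuous (Function.uncurry q)
  cm : Continuous (Function.uncurry m)
  cs : Continuous (Function.uncurry s)
  cr : Continuous (Function.uncurry r)
  u_t : ∀ t x, HasDerivAt (fun y => u y x) (p t x) t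
  p_t : ∀ t x, HasDerivAt (fun y => p y x) (s t x) t
  q_t : ∀ t x, HasDerivAt (fun y => q y x) (m t x) t
  u_x : ∀ t x, HasDerivAt (u t) (q t x) x
  p_x : ∀ t x, HasDerivAt (p t) (m t x) x
  q_x : ∀ t x, HasDerivAt (q t) (r t x) x
  pde : ∀ t > 0, ∀ x, s t x = r t x - V x * u t x - a x * p t x
  u_van : ∀ t ∈ Set.Icc 0 T, ∀ x, R ≤ |x| → u t x = 0
  q_van : ∀ t ∈ Set.Icc 0 T, ∀ x, R ≤ |x| → q t x = 0
  p_van : ∀ t ∈ Set.Ioc 0 T, ∀ x, R ≤ |x| → p t x = 0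

lemma reg_t {u : ℝ → ℝ → ℝ} (hu : ContDiff ℝ (⊤ : ℕ∞) (fun p : ℝ × ℝ => u p.1 p.2)) (t x : ℝ) :
    HasDerivAt (fun y => u y x) (fderiv ℝ (fun p : ℝ × ℝ => u p.1 p.2) (t, x) (1, 0)) t := by
  have h1 := (hu.differentiable (by simp) (t, x)).hasFDerivAt
  have h2 : HasDerivAt (fun y : ℝ => (y, x)) ((1 : ℝ), (0 : ℝ)) t :=
    (hasDerivAt_id t).prodMk (hasDerivAt_const t x)
  exact HasFDerivAt.comp_hasDerivAt (f := fun y : ℝ => (y, x)) t h1 h2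

lemma reg_x {u : ℝ → ℝ → ℝ} (hu : ContDiff ℝ (⊤ : ℕ∞) (fun p : ℝ × ℝ => u p.1 p.2)) (t x : ℝ) :
    HasDerivAt (fun y => u t y) (fderiv ℝ (fun p : ℝ × ℝ => u p.1 p.2) (t, x) (0, 1)) x := by
  have h1 := (hu.differentiable (by simp) (t, x)).hasFDerivAt
  have h2 : HasDerivAt (fun y : ℝ => (t, y)) ((0 : ℝ), (1 : ℝ)) x :=
    (hasDerivAt_const x t).prodMk (hasDerivAt_id x)
  exact HasFDerivAt.comp_hasDerivAt (f := fun y : ℝ => (t, y)) x h1 h2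

lemma ut_eq {u : ℝ → ℝ → ℝ} (hu : ContDiff ℝ (⊤ : ℕ∞) (fun p : ℝ × ℝ => u p.1 p.2)) (t x : ℝ) :
    ut u t x = fderiv ℝ (fun p : ℝ × ℝ => u p.1 p.2) (t, x) (1, 0) := (reg_t hu t x).deriv

lemma ux_eq {u : ℝ → ℝ → ℝ} (hu : ContDiff ℝ (⊤ : ℕ∞) (fun p : ℝ × ℝ => u p.1 p.2)) (t x : ℝ) :
    ux u t x = fderiv ℝ (fun p : ℝ × ℝ => u p.1 p.2) (t, x) (0, 1) := (reg_x hu t x).deriv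

lemma ut_hasDeriv {u : ℝ → ℝ → ℝ} (hu : ContDiff ℝ (⊤ : ℕ∞) (fun p : ℝ × ℝ => u p.1 p.2))
    (t x : ℝ) : HasDerivAt (fun y => u y x) (ut u t x) t := by
  rw [ut_eq hu]; exact reg_t hu t x

lemma ux_hasDeriv {u : ℝ → ℝ → ℝ} (hu : ContDiff ℝ (⊤ : ℕ∞) (fun p : ℝ × ℝ => u p.1 p.2))
    (t x : ℝ) : HasDerivAt (fun y => u t y) (ux u t x) x := by
  rw [ux_eq hu]; exact reg_x hu t x

lemma ut_smooth {u : ℝ → ℝ → ℝ} (hu : ContDiff ℝ (⊤ : ℕ∞) (fun p : ℝ × ℝ => u p.1 p.2)) :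
    ContDiff ℝ (⊤ : ℕ∞) (fun p : ℝ × ℝ => ut u p.1 p.2) := by
  have : (fun p : ℝ × ℝ => ut u p.1 p.2)
      = fun p => fderiv ℝ (fun p : ℝ × ℝ => u p.1 p.2) p (1, 0) := by
    ext p; exact ut_eq hu p.1 p.2
  rw [this]
  exact (hu.fderiv_right (m := (⊤ : ℕ∞)) (by simp)).clm_apply contDiff_const

lemma ux_smooth {u : ℝ → ℝ → ℝ} (hu : ContDiff ℝ (⊤ : ℕ∞) (fun p : ℝ × ℝ => u p.1 p.2)) :
    ContDiff ℝ (⊤ : ℕ∞) (fun p : ℝ × ℝ => ux u p.1 p.2) := by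
  have : (fun p : ℝ × ℝ => ux u p.1 p.2)
      = fun p => fderiv ℝ (fun p : ℝ × ℝ => u p.1 p.2) p (0, 1) := by
    ext p; exact ux_eq hu p.1 p.2
  rw [this]
  exact (hu.fderiv_right (m := (⊤ : ℕ∞)) (by simp)).clm_apply contDiff_const

lemma mixed_symm {u : ℝ → ℝ → ℝ} (hu : ContDiff ℝ (⊤ : ℕ∞) (fun p : ℝ × ℝ => u p.1 p.2))
    (t x : ℝ) : ut (ux u) t x = ux (ut u) t x := by
  have e1 : (fun p : ℝ × ℝ => ut u p.1 p.2)
      = fun p => fderiv ℝ (fun p : ℝ × ℝ => u p.1 p.2) p (1, 0) := by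
    ext p; exact ut_eq hu p.1 p.2
  have e2 : (fun p : ℝ × ℝ => ux u p.1 p.2)
      = fun p => fderiv ℝ (fun p : ℝ × ℝ => u p.1 p.2) p (0, 1) := by
    ext p; exact ux_eq hu p.1 p.2
  have hd : Differentiable ℝ (fderiv ℝ (fun p : ℝ × ℝ => u p.1 p.2)) :=
    (hu.fderiv_right (m := (⊤ : ℕ∞)) (by simp)).differentiable (by simp)
  have hdd : ∀ v w : ℝ × ℝ, ∀ z, fderiv ℝ (fun p => fderiv ℝ (fun p : ℝ × ℝ => u p.1 p.2) p v) z w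
      = fderiv ℝ (fderiv ℝ (fun p : ℝ × ℝ => u p.1 p.2)) z w v := by
    intro v w z
    have := ((hd z).hasFDerivAt.clm_apply (hasFDerivAt_const v z)).fderiv
    rw [this]; simp
  rw [ut_eq (ux_smooth hu), ux_eq (ut_smooth hu), e1, e2, hdd, hdd]
  exact second_derivative_symmetric
    (fun y => (hu.differentiable (by simp) y).hasFDerivAt) (hd (t, x)).hasFDerivAt _ _

lemma solData_of {V a : ℝ → ℝ} {u : ℝ → ℝ → ℝ} {u₀ u₁ : ℝ → ℝ}
    (h : IsSmoothSolution V a u u₀ u₁) (T : ℝ) (hT : 0 ≤ T) (L : ℝ) :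
    ∃ R, L ≤ R ∧ 0 < R ∧
      SolData V a u (ut u) (ux u) (ux (ut u)) (utt u) (uxx u) T R := by
  obtain ⟨hu, pde, -, -, -, -, -, -, hv⟩ := h
  obtain ⟨R, hR, hv⟩ := hv (T + 1) (by linarith)
  have hp := ut_smooth hu
  have hq := ux_smooth hu
  refine ⟨max L (R + 1), le_max_left _ _, lt_of_lt_of_le (by linarith) (le_max_right _ _), ?_⟩
  have hbig : ∀ x : ℝ, max L (R + 1) ≤ |x| → R < |x| := fun x hx => by
    have := le_max_right L (R + 1); linarith
  exact {
    cu := hu.continuous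
    cp := hp.continuous
    cq := hq.continuous
    cm := (ux_smooth hp).continuous
    cs := (ut_smooth hp).continuous
    cr := (ux_smooth hq).continuous
    u_t := ut_hasDeriv hu
    p_t := ut_hasDeriv hp
    q_t := fun t x => by rw [← mixed_symm hu]; exact ut_hasDeriv hq t x
    u_x := ux_hasDeriv hu
    p_x := ux_hasDeriv hp
    q_x := ux_hasDeriv hq
    pde := fun t ht x => by linarith [pde t ht x]
    u_van := fun t ht x hx => hv t ⟨ht.1, by linarith [ht.2]⟩ x (hbig x hx).le
    q_van := fun t ht x hx => by
      have : (fun y => u t y) =ᶠ[nhds x] fun _ => 0 := by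
        have ho : {y : ℝ | R < |y|} ∈ nhds x :=
          (isOpen_lt continuous_const continuous_abs).mem_nhds (hbig x hx)
        filter_upwards [ho] with y hy
        exact hv t ⟨ht.1, by linarith [ht.2]⟩ y (le_of_lt hy)
      unfold ux
      rw [this.deriv_eq]; simp
    p_van := fun t ht x hx => by
      have : (fun y => u y x) =ᶠ[nhds t] fun _ => 0 := by
        have ho : Set.Ioo 0 (T + 1) ∈ nhds t := Ioo_mem_nhds ht.1 (by linarith [ht.2])
        filter_upwards [ho] with y hy
        exact hv y ⟨hy.1.le, hy.2.le⟩ x (hbig x hx).le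
      unfold ut
      rw [this.deriv_eq]; simp }

lemma swap_int {g : ℝ → ℝ → ℝ} (hg : Continuous (Function.uncurry g)) (c d α β : ℝ)
    (hαβ : α ≤ β) :
    ∫ t in c..d, ∫ x in α..β, g t x = ∫ x in α..β, ∫ t in c..d, g t x := by
  simp only [intervalIntegral.integral_of_le hαβ]
  apply intervalIntegral_integral_swap
  rw [Measure.prod_restrict]
  have : IntegrableOn (Function.uncurry g) (Set.uIcc c d ×ˢ Set.Icc α β) (volume.prod volume) :=
    hg.continuousOn.integrableOn_compact (isCompact_uIcc.prod isCompact_Icc)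
  exact this.mono_set (Set.prod_mono Set.uIoc_subset_uIcc Set.Ioc_subset_Icc_self)

lemma TS {g g' : ℝ → ℝ → ℝ} (hg : ∀ t x, HasDerivAt (fun y => g y x) (g' t x) t)
    (hc : Continuous (Function.uncurry g')) (hgc : ∀ t, Continuous (g t)) (c d R : ℝ)
    (hR : 0 < R) :
    (∫ x in -R..R, g d x) - (∫ x in -R..R, g c x) = ∫ t in c..d, ∫ x in -R..R, g' t x := by
  rw [swap_int hc _ _ _ _ (by linarith),
    ← intervalIntegral.integral_sub ((hgc d).intervalIntegrable _ _)
      ((hgc c).intervalIntegrable _ _)]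
  congr 1; ext x
  rw [intervalIntegral.integral_eq_sub_of_hasDerivAt (fun t _ => hg t x)]
  apply Continuous.intervalIntegrable
  fun_prop

/-- integral of a derivative vanishing at the end points -/
lemma int_zero {F F' : ℝ → ℝ} (hF : ∀ x, HasDerivAt F (F' x) x) (hc : Continuous F') (R : ℝ)
    (h1 : F R = 0) (h2 : F (-R) = 0) : ∫ x in -R..R, F' x = 0 := by
  rw [intervalIntegral.integral_eq_sub_of_hasDerivAt (fun x _ => hF x)
    (hc.intervalIntegrable _ _), h1, h2, sub_zero]

/-- the truncated identity -/
noncomputable def hh (L x : ℝ) : ℝ := max (-L) (min x L)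

lemma hh_cont (L : ℝ) : Continuous (hh L) := by unfold hh; fun_prop

lemma hh_bd {L : ℝ} (hL : 0 < L) (x : ℝ) : |hh L x| ≤ L := by
  unfold hh; rw [abs_le]
  exact ⟨le_max_left _ _, max_le (by linarith) (min_le_right _ _)⟩

lemma hh_mul {L : ℝ} (hL : 0 < L) {V : ℝ → ℝ} (hV2 : ∀ x, deriv V x * x ≤ 0) (x : ℝ) :
    deriv V x * hh L x ≤ 0 := by
  have h := hV2 x
  rcases lt_trichotomy x 0 with hx | hx | hx
  · have h1 : 0 ≤ deriv V x := by by_contra hc; nlinarith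
    have h2 : hh L x ≤ 0 := max_le (by linarith) ((min_le_left _ _).trans hx.le)
    nlinarith
  · subst hx; simp [hh, hL.le]
  · have h1 : deriv V x ≤ 0 := by by_contra hc; nlinarith
    have h2 : 0 ≤ hh L x := le_max_of_le_right (le_min hx.le hL.le)
    nlinarith

/-- integration by parts against the truncated identity -/
lemma int_hh {F F' : ℝ → ℝ} (hF : ∀ x, HasDerivAt F (F' x) x) (hc : Continuous F') {L R : ℝ}
    (hL : 0 < L) (hLR : L ≤ R) (h1 : F R = 0) (h2 : F (-R) = 0) :
    ∫ x in -R..R, hh L x * F' x = - ∫ x in -L..L, F x := by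
  have hI : ∀ c d, IntervalIntegrable (fun x => hh L x * F' x) volume c d := fun c d =>
    ((hh_cont L).mul hc).intervalIntegrable _ _
  have hFc : Continuous F := continuous_iff_continuousAt.2 fun x => (hF x).continuousAt
  rw [← intervalIntegral.integral_add_adjacent_intervals (hI (-R) (-L)) (hI (-L) R),
    ← intervalIntegral.integral_add_adjacent_intervals (hI (-L) L) (hI L R)]
  have e1 : ∫ x in -R..-L, hh L x * F' x = - L * F (-L) := by
    have : ∫ x in -R..-L, hh L x * F' x = ∫ x in -R..-L, (-L) * F' x := by
      apply intervalIntegral.integral_congr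
      intro x hx
      rw [Set.uIcc_of_le (by linarith)] at hx
      have : hh L x = -L := max_eq_left ((min_le_left _ _).trans hx.2)
      simp [this]
    rw [this, intervalIntegral.integral_const_mul,
      intervalIntegral.integral_eq_sub_of_hasDerivAt (fun x _ => hF x)
        (hc.intervalIntegrable _ _), h2]; ring
  have e3 : ∫ x in L..R, hh L x * F' x = - L * F L := by
    have : ∫ x in L..R, hh L x * F' x = ∫ x in L..R, L * F' x := by
      apply intervalIntegral.integral_congr
      intro x hx
      rw [Set.uIcc_of_le (by linarith)] at hx
      have : hh L x = L := by unfold hh; rw [min_eq_right hx.1]; exact max_eq_right (by linarith)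
      simp [this]
    rw [this, intervalIntegral.integral_const_mul,
      intervalIntegral.integral_eq_sub_of_hasDerivAt (fun x _ => hF x)
        (hc.intervalIntegrable _ _), h1]; ring
  have e2 : ∫ x in -L..L, hh L x * F' x = L * F L + L * F (-L) - ∫ x in -L..L, F x := by
    have : ∫ x in -L..L, hh L x * F' x = ∫ x in -L..L, ((1 * F x + x * F' x) - F x) := by
      apply intervalIntegral.integral_congr
      intro x hx
      rw [Set.uIcc_of_le (by linarith)] at hx
      have : hh L x = x := by unfold hh; rw [min_eq_left hx.2]; exact max_eq_right hx.1
      simp [this]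
    rw [this, intervalIntegral.integral_sub
      (Continuous.intervalIntegrable (by fun_prop) _ _) (hFc.intervalIntegrable _ _),
      intervalIntegral.integral_deriv_mul_eq_sub (u := fun x => x) (fun x _ => hasDerivAt_id x)
        (fun x _ => hF x) (Continuous.intervalIntegrable (by fun_prop) _ _)
        (hc.intervalIntegrable _ _)]
    ring
  rw [e1, e2, e3]; ring

section core
variable {V a : ℝ → ℝ} {u p q m s r : ℝ → ℝ → ℝ} {T R : ℝ}

lemma energy_id (S : SolData V a u p q m s r T R) (hV : Continuous V) (ha : Continuous a)
    (hR : 0 < R) {c d : ℝ} (hc : 0 ≤ c) (hcd : c ≤ d) (hd : d ≤ T) :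
    (∫ x in -R..R, (p d x ^ 2 + q d x ^ 2 + V x * u d x ^ 2))
      - (∫ x in -R..R, (p c x ^ 2 + q c x ^ 2 + V x * u c x ^ 2))
      = - 2 * ∫ t in c..d, ∫ x in -R..R, a x * p t x ^ 2 := by
  obtain ⟨cu, cp, cq, cm, cs, cr, u_t, p_t, q_t, u_x, p_x, q_x, pde, u_van, q_van, p_van⟩ := S
  rw [TS (g := fun t x => p t x ^ 2 + q t x ^ 2 + V x * u t x ^ 2)
    (g' := fun t x => 2 * p t x * s t x + 2 * q t x * m t x + V x * (2 * u t x * p t x))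
    ?_ (by fun_prop) (by intro t; fun_prop) c d R hR]
  · rw [← intervalIntegral.integral_const_mul]
    apply intervalIntegral.integral_congr_ae
    refine Filter.Eventually.of_forall fun t ht => ?_
    rw [Set.uIoc_of_le hcd] at ht
    have ht0 : 0 < t := lt_of_le_of_lt hc ht.1
    have htT : t ≤ T := ht.2.trans hd
    have h0 : ∫ x in -R..R, (m t x * q t x + p t x * r t x) = 0 :=
      int_zero (F := fun x => p t x * q t x) (fun x => (p_x t x).mul (q_x t x)) (by fun_prop) R
        (by simp [p_van t ⟨ht0, htT⟩ R (le_abs_self R)])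
        (by simp [p_van t ⟨ht0, htT⟩ (-R) (by rw [abs_neg]; exact le_abs_self R)])
    have : (∫ x in -R..R, (2 * p t x * s t x + 2 * q t x * m t x + V x * (2 * u t x * p t x)))
      = ∫ x in -R..R, (2 * (m t x * q t x + p t x * r t x) + (-2) * (a x * p t x ^ 2)) := by
      congr 1; ext x; rw [pde t ht0 x]; ring
    rw [this, intervalIntegral.integral_add (Continuous.intervalIntegrable (by fun_prop) _ _)
      (Continuous.intervalIntegrable (by fun_prop) _ _), intervalIntegral.integral_const_mul,
      intervalIntegral.integral_const_mul, h0]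
    ring
  · intro t x
    have := (((p_t t x).pow 2).add ((q_t t x).pow 2)).add (((u_t t x).pow 2).const_mul (V x))
    exact this.congr_deriv (by norm_num)

lemma v_pde (S : SolData V a u p q m s r T R) {t : ℝ} (ht : 0 ≤ t) (x : ℝ) :
    ∫ y in 0..t, r y x = p t x - p 0 x + V x * (∫ y in 0..t, u y x) + a x * (u t x - u 0 x) := by
  obtain ⟨cu, cp, cq, cm, cs, cr, u_t, p_t, q_t, u_x, p_x, q_x, pde, u_van, q_van, p_van⟩ := S
  have e1 : ∫ y in 0..t, s y x = p t x - p 0 x :=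
    intervalIntegral.integral_eq_sub_of_hasDerivAt (fun y _ => p_t y x)
      (Continuous.intervalIntegrable (by fun_prop) _ _)
  have e2 : ∫ y in 0..t, p y x = u t x - u 0 x :=
    intervalIntegral.integral_eq_sub_of_hasDerivAt (fun y _ => u_t y x)
      (Continuous.intervalIntegrable (by fun_prop) _ _)
  have e3 : ∫ y in 0..t, s y x = ∫ y in 0..t, (r y x - V x * u y x - a x * p y x) := by
    apply intervalIntegral.integral_congr_ae
    refine Filter.Eventually.of_forall fun y hy => ?_
    rw [Set.uIoc_of_le ht] at hy
    exact pde y hy.1 x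
  rw [intervalIntegral.integral_sub (Continuous.intervalIntegrable (by fun_prop) _ _)
      (Continuous.intervalIntegrable (by fun_prop) _ _),
      intervalIntegral.integral_sub (Continuous.intervalIntegrable (by fun_prop) _ _)
      (Continuous.intervalIntegrable (by fun_prop) _ _), intervalIntegral.integral_const_mul,
      intervalIntegral.integral_const_mul] at e3
  rw [← e1, ← e2, e3]; ring

lemma prim_deriv {u : ℝ → ℝ → ℝ} (cu : Continuous (Function.uncurry u)) (t x : ℝ) :
    HasDerivAt (fun t => ∫ y in 0..t, u y x) (u t x) t := by
  have : Continuous fun y => u y x := by fun_prop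
  exact this.integral_hasStrictDerivAt 0 t |>.hasDerivAt

lemma prim_cont {u : ℝ → ℝ → ℝ} (cu : Continuous (Function.uncurry u)) :
    Continuous (Function.uncurry fun t x => ∫ y in 0..t, u y x) := by
  have h : Continuous (Function.uncurry fun (z : ℝ × ℝ) y => u y z.2) := by
    show Continuous fun w : (ℝ × ℝ) × ℝ => u w.2 w.1.2
    fun_prop
  exact intervalIntegral.continuous_parametric_intervalIntegral_of_continuous (a₀ := 0) h
    continuous_fst

lemma mult_v (S : SolData V a u p q m s r T R) (hV : Continuous V) (ha : Continuous a)
    (hVp : ∀ x, 0 < V x) (hR : 0 < R) (hT : 0 ≤ T) :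
    (∫ x in -R..R, u T x ^ 2) + 2 * (∫ t in 0..T, ∫ x in -R..R, a x * u t x ^ 2)
      ≤ (∫ x in -R..R, u 0 x ^ 2) + ∫ x in -R..R, (p 0 x + a x * u 0 x) ^ 2 / V x := by
  have vp := fun {t} ht x => v_pde S (t := t) ht x
  obtain ⟨cu, cp, cq, cm, cs, cr, u_t, p_t, q_t, u_x, p_x, q_x, pde, u_van, q_van, p_van⟩ := S
  set v : ℝ → ℝ → ℝ := fun t x => ∫ y in 0..t, u y x with hv
  set w : ℝ → ℝ → ℝ := fun t x => ∫ y in 0..t, q y x with hw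
  have cv : Continuous (Function.uncurry v) := prim_cont cu
  have cw : Continuous (Function.uncurry w) := prim_cont cq
  set f : ℝ → ℝ := fun x => p 0 x + a x * u 0 x with hf
  have cf : Continuous f := by fun_prop
  have key := TS (g := fun t x => u t x ^ 2 + w t x ^ 2 + V x * v t x ^ 2 - 2 * f x * v t x)
    (g' := fun t x => 2 * u t x * p t x + 2 * w t x * q t x + V x * (2 * v t x * u t x)
      - 2 * f x * u t x) ?_ (by fun_prop) (by intro t; fun_prop) 0 T R hR
  swap
  · intro t x
    have h1 : HasDerivAt (fun y => v y x) (u t x) t := prim_deriv cu t x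
    have h2 : HasDerivAt (fun y => w y x) (q t x) t := prim_deriv cq t x
    have := ((((u_t t x).pow 2).add (h2.pow 2)).add ((h1.pow 2).const_mul (V x))).sub
      (h1.const_mul (2 * f x))
    exact this.congr_deriv (by norm_num)
  have hrhs : (∫ t in 0..T, ∫ x in -R..R, (2 * u t x * p t x + 2 * w t x * q t x
      + V x * (2 * v t x * u t x) - 2 * f x * u t x))
      = - 2 * ∫ t in 0..T, ∫ x in -R..R, a x * u t x ^ 2 := by
    rw [← intervalIntegral.integral_const_mul]
    apply intervalIntegral.integral_congr_ae
    refine Filter.Eventually.of_forall fun t ht => ?_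
    rw [Set.uIoc_of_le hT] at ht
    have h0 : ∀ y, ∫ x in -R..R, (q t x * q y x + u t x * r y x) = 0 := fun y =>
      int_zero (F := fun x => u t x * q y x) (fun x => (u_x t x).mul (q_x y x)) (by fun_prop) R
        (by simp [u_van t ⟨ht.1.le, ht.2⟩ R (le_abs_self R)])
        (by simp [u_van t ⟨ht.1.le, ht.2⟩ (-R) (by rw [abs_neg]; exact le_abs_self R)])
    have h1 : ∫ x in -R..R, (q t x * w t x + u t x * ∫ y in 0..t, r y x) = 0 := by
      have hsw := swap_int (g := fun y x => q t x * q y x + u t x * r y x) (by fun_prop) 0 t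
        (-R) R (by linarith)
      simp only [h0, intervalIntegral.integral_zero] at hsw
      refine Eq.trans ?_ hsw.symm
      congr 1; ext x
      rw [intervalIntegral.integral_add (Continuous.intervalIntegrable (by fun_prop) _ _)
        (Continuous.intervalIntegrable (by fun_prop) _ _), intervalIntegral.integral_const_mul,
        intervalIntegral.integral_const_mul]
    have cR : Continuous fun x => ∫ y in 0..t, r y x := by
      have := prim_cont cr
      fun_prop
    have : (∫ x in -R..R, (2 * u t x * p t x + 2 * w t x * q t x
      + V x * (2 * v t x * u t x) - 2 * f x * u t x))
      = ∫ x in -R..R, (2 * (q t x * w t x + u t x * ∫ y in 0..t, r y x)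
        + (-2) * (a x * u t x ^ 2)) := by
      congr 1; ext x; rw [vp ht.1.le x]; simp only [hf, hv]; ring
    rw [this, intervalIntegral.integral_add (Continuous.intervalIntegrable (by fun_prop) _ _)
      (Continuous.intervalIntegrable (by fun_prop) _ _), intervalIntegral.integral_const_mul,
      intervalIntegral.integral_const_mul, h1]
    ring
  rw [hrhs] at key
  have h00 : (∫ x in -R..R, (u 0 x ^ 2 + w 0 x ^ 2 + V x * v 0 x ^ 2 - 2 * f x * v 0 x))
      = ∫ x in -R..R, u 0 x ^ 2 := by
    congr 1; ext x; simp [hv, hw]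
  rw [h00] at key
  have hle : (∫ x in -R..R, (u T x ^ 2 - f x ^ 2 / V x))
      ≤ ∫ x in -R..R, (u T x ^ 2 + w T x ^ 2 + V x * v T x ^ 2 - 2 * f x * v T x) := by
    apply intervalIntegral.integral_mono_on (by linarith)
    · exact Continuous.intervalIntegrable
        ((by fun_prop : Continuous fun x => u T x ^ 2).sub
          ((cf.pow 2).div hV fun x => (hVp x).ne')) _ _
    · exact Continuous.intervalIntegrable (by fun_prop) _ _
    · intro x _
      have hx := hVp x
      have e : V x * v T x ^ 2 - 2 * f x * v T x + f x ^ 2 / V x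
          = V x * (v T x - f x / V x) ^ 2 := by
        field_simp; ring
      have := mul_nonneg hx.le (sq_nonneg (v T x - f x / V x))
      nlinarith [sq_nonneg (w T x)]
  rw [intervalIntegral.integral_sub (Continuous.intervalIntegrable (by fun_prop) _ _)
    (Continuous.intervalIntegrable (by
      have : Continuous fun x => f x ^ 2 / V x := (cf.pow 2).div hV fun x => (hVp x).ne'
      exact this) _ _)] at hle
  linarith

/-- derivative of the combined multiplier functional, at a fixed time -/
lemma mult_h_id (S : SolData V a u p q m s r T R) (hV : ContDiff ℝ 1 V) (ha : Continuous a)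
    {L : ℝ} (hL : 0 < L) (hLR : L ≤ R) {t : ℝ} (ht : t ∈ Set.Ioc 0 T) :
    (∫ x in -R..R, (hh L x * (m t x * p t x + q t x * s t x)
      + (1 / 4) * (p t x ^ 2 + u t x * s t x + a x * (u t x * p t x))))
    = - (∫ x in -L..L, (1 / 2) * (p t x ^ 2 + q t x ^ 2 - V x * u t x ^ 2))
      + ∫ x in -R..R, ((1 / 2) * (deriv V x * hh L x) * u t x ^ 2
        - a x * hh L x * q t x * p t x
        + (1 / 4) * (p t x ^ 2 - q t x ^ 2 - V x * u t x ^ 2)) := by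
  obtain ⟨cu, cp, cq, cm, cs, cr, u_t, p_t, q_t, u_x, p_x, q_x, pde, u_van, q_van, p_van⟩ := S
  have cV := hV.continuous
  have cV' : Continuous (deriv V) := hV.continuous_deriv le_rfl
  have chh := hh_cont L
  have hVd : ∀ x, HasDerivAt V (deriv V x) x := fun x =>
    (hV.differentiable one_ne_zero x).hasDerivAt
  have hR1 := le_abs_self R
  have hR2 : R ≤ |-R| := by rw [abs_neg]; exact hR1
  have ht' : t ∈ Set.Icc 0 T := ⟨ht.1.le, ht.2⟩
  have h1 := int_hh (F := fun x => (1 / 2) * (p t x ^ 2 + q t x ^ 2 - V x * u t x ^ 2))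
    (F' := fun x => p t x * m t x + q t x * r t x - V x * u t x * q t x
      - (1 / 2) * deriv V x * u t x ^ 2) (L := L) (R := R) ?_ (by fun_prop) hL hLR
    (by simp [u_van t ht' R hR1, q_van t ht' R hR1, p_van t ht R hR1])
    (by simp [u_van t ht' _ hR2, q_van t ht' _ hR2, p_van t ht _ hR2])
  swap
  · intro x
    have := ((((p_x t x).pow 2).add ((q_x t x).pow 2)).sub
      ((hVd x).mul ((u_x t x).pow 2))).const_mul (1 / 2)
    exact this.congr_deriv (by simp only [Pi.pow_apply, Nat.cast_ofNat, Nat.add_one_sub_one, pow_one]; ring)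
  have h2 : ∫ x in -R..R, (q t x * q t x + u t x * r t x) = 0 :=
    int_zero (F := fun x => u t x * q t x) (fun x => (u_x t x).mul (q_x t x)) (by fun_prop) R
        (by simp [u_van t ht' R hR1]) (by simp [u_van t ht' _ hR2])
  have e : (∫ x in -R..R, (hh L x * (m t x * p t x + q t x * s t x)
      + (1 / 4) * (p t x ^ 2 + u t x * s t x + a x * (u t x * p t x))))
    = ∫ x in -R..R, (hh L x * (p t x * m t x + q t x * r t x - V x * u t x * q t x
      - (1 / 2) * deriv V x * u t x ^ 2) + (1 / 4) * (q t x * q t x + u t x * r t x)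
      + ((1 / 2) * (deriv V x * hh L x) * u t x ^ 2
        - a x * hh L x * q t x * p t x
        + (1 / 4) * (p t x ^ 2 - q t x ^ 2 - V x * u t x ^ 2))) := by
    congr 1; ext x; rw [pde t ht.1 x]; ring
  rw [e, intervalIntegral.integral_add (Continuous.intervalIntegrable (by fun_prop) _ _)
      (Continuous.intervalIntegrable (by fun_prop) _ _),
      intervalIntegral.integral_add (Continuous.intervalIntegrable (by fun_prop) _ _)
      (Continuous.intervalIntegrable (by fun_prop) _ _), h1,
      intervalIntegral.integral_const_mul (1 / 4 : ℝ) (fun x => q t x * q t x + u t x * r t x), h2]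
  ring

end core

lemma out_bd {a w : ℝ → ℝ} {L R ε₁ : ℝ} (ha : Continuous a) (hw : Continuous w)
    (hL : 0 < L) (hLR : L ≤ R) (hε : 0 < ε₁) (ha0 : ∀ x, 0 ≤ a x)
    (hae : ∀ x : ℝ, L ≤ |x| → ε₁ ≤ a x) :
    (∫ x in -R..R, w x ^ 2) - (∫ x in -L..L, w x ^ 2) ≤ (1 / ε₁) * ∫ x in -R..R, a x * w x ^ 2 := by
  have hI : ∀ c d, IntervalIntegrable (fun x => w x ^ 2) volume c d := fun c d =>
    Continuous.intervalIntegrable (by fun_prop) _ _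
  have hJ : ∀ c d, IntervalIntegrable (fun x => (1 / ε₁) * (a x * w x ^ 2)) volume c d :=
    fun c d => Continuous.intervalIntegrable (by fun_prop) _ _
  rw [← intervalIntegral.integral_const_mul,
    ← intervalIntegral.integral_add_adjacent_intervals (hI (-R) (-L)) (hI (-L) R),
    ← intervalIntegral.integral_add_adjacent_intervals (hI (-L) L) (hI L R),
    ← intervalIntegral.integral_add_adjacent_intervals (hJ (-R) (-L)) (hJ (-L) R),
    ← intervalIntegral.integral_add_adjacent_intervals (hJ (-L) L) (hJ L R)]
  have hpt : ∀ x : ℝ, L ≤ |x| → w x ^ 2 ≤ (1 / ε₁) * (a x * w x ^ 2) := by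
    intro x hx
    have h1 := mul_le_mul_of_nonneg_right (hae x hx) (sq_nonneg (w x))
    have h2 := mul_le_mul_of_nonneg_left h1 (one_div_pos.2 hε).le
    calc w x ^ 2 = 1 / ε₁ * (ε₁ * w x ^ 2) := by field_simp
      _ ≤ _ := h2
  have h1 : ∫ x in -R..-L, w x ^ 2 ≤ ∫ x in -R..-L, (1 / ε₁) * (a x * w x ^ 2) :=
    intervalIntegral.integral_mono_on (by linarith) (hI _ _) (hJ _ _) fun x hx =>
      hpt x (by rw [le_abs]; right; linarith [hx.2])
  have h3 : ∫ x in L..R, w x ^ 2 ≤ ∫ x in L..R, (1 / ε₁) * (a x * w x ^ 2) :=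
    intervalIntegral.integral_mono_on (by linarith) (hI _ _) (hJ _ _) fun x hx =>
      hpt x (by rw [le_abs]; left; linarith [hx.1])
  have h2 : 0 ≤ ∫ x in -L..L, (1 / ε₁) * (a x * w x ^ 2) :=
    intervalIntegral.integral_nonneg (by linarith) fun x _ =>
      mul_nonneg (one_div_pos.2 hε).le (mul_nonneg (ha0 x) (sq_nonneg _))
  linarith

lemma setInt_eq (g : ℝ → ℝ) {L : ℝ} (hL : 0 < L) :
    ∫ x in {x : ℝ | |x| ≤ L}, g x = ∫ x in -L..L, g x := by
  have : {x : ℝ | |x| ≤ L} = Set.Icc (-L) L := by ext x; simp [abs_le]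
  rw [this, integral_Icc_eq_integral_Ioc, intervalIntegral.integral_of_le (by linarith)]

lemma full_eq {g : ℝ → ℝ} {R : ℝ} (hg : ∀ x : ℝ, R ≤ |x| → g x = 0) :
    ∫ x in -R..R, g x = ∫ x, g x := by
  apply intervalIntegral.integral_eq_integral_of_support_subset
  intro x hx
  have : |x| < R := by
    by_contra hc
    exact hx (hg x (not_lt.1 hc))
  rw [abs_lt] at this
  exact ⟨this.1, this.2.le⟩

lemma full_integrable {g : ℝ → ℝ} {R : ℝ} (hc : Continuous g)
    (hg : ∀ x : ℝ, R ≤ |x| → g x = 0) : Integrable g := by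
  apply hc.integrable_of_hasCompactSupport
  apply HasCompactSupport.intro (isCompact_Icc (a := -R) (b := R))
  intro x hx
  apply hg
  by_contra hc
  rw [not_le, abs_lt] at hc
  exact hx ⟨hc.1.le, hc.2.le⟩

lemma poincare_int {a w w' : ℝ → ℝ} {L R ε₁ Cstar : ℝ} (ha : Continuous a)
    (hL : 0 < L) (hε : 0 < ε₁) (hC : 0 < Cstar) (ha0 : ∀ x, 0 ≤ a x)
    (hae : ∀ x : ℝ, L ≤ |x| → ε₁ ≤ a x)
    (hP : ∀ w : ℝ → ℝ, ContDiff ℝ 1 w →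
      Integrable (fun x => w x ^ 2) → Integrable (fun x => deriv w x ^ 2) →
      ∫ x in {x : ℝ | |x| ≤ L}, w x ^ 2 ≤
        Cstar * ((∫ x, deriv w x ^ 2) + ∫ x in {x : ℝ | L ≤ |x|}, w x ^ 2))
    (hw : ∀ x, HasDerivAt w (w' x) x) (hc : Continuous w')
    (v1 : ∀ x, R ≤ |x| → w x = 0) (v2 : ∀ x, R ≤ |x| → w' x = 0) :
    ∫ x in -L..L, w x ^ 2 ≤
      Cstar * ((∫ x in -R..R, w' x ^ 2) + (1 / ε₁) * ∫ x in -R..R, a x * w x ^ 2) := by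
  have hd : deriv w = w' := by ext x; exact (hw x).deriv
  have hwc : Continuous w := continuous_iff_continuousAt.2 fun x => (hw x).continuousAt
  have hw1 : ContDiff ℝ 1 w := by
    rw [contDiff_one_iff_deriv]
    exact ⟨fun x => (hw x).differentiableAt, by rw [hd]; exact hc⟩
  have i1 : Integrable (fun x => w x ^ 2) :=
    full_integrable (R := R) (by fun_prop) (fun x hx => by simp [v1 x hx])
  have i2 : Integrable (fun x => w' x ^ 2) :=
    full_integrable (R := R) (by fun_prop) (fun x hx => by simp [v2 x hx])
  have i3 : Integrable (fun x => (1 / ε₁) * (a x * w x ^ 2)) :=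
    full_integrable (R := R) (by fun_prop) (fun x hx => by simp [v1 x hx])
  have h := hP w hw1 i1 (by rw [hd]; exact i2)
  rw [setInt_eq _ hL, hd] at h
  refine h.trans (mul_le_mul_of_nonneg_left ?_ hC.le)
  rw [full_eq (fun x hx => by simp [v2 x hx]), full_eq (fun x hx => by simp [v1 x hx]),
    ← integral_const_mul]
  have hm : MeasurableSet {x : ℝ | L ≤ |x|} :=
    (isClosed_le continuous_const continuous_abs).measurableSet
  have h1 : ∫ x in {x : ℝ | L ≤ |x|}, w x ^ 2
      ≤ ∫ x in {x : ℝ | L ≤ |x|}, (1 / ε₁) * (a x * w x ^ 2) := by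
    refine setIntegral_mono_on i1.integrableOn i3.integrableOn hm ?_
    intro x hx
    have h1 := mul_le_mul_of_nonneg_right (hae x hx) (sq_nonneg (w x))
    have h2 := mul_le_mul_of_nonneg_left h1 (one_div_pos.2 hε).le
    calc w x ^ 2 = 1 / ε₁ * (ε₁ * w x ^ 2) := by field_simp
      _ ≤ _ := h2
  have h2 : ∫ x in {x : ℝ | L ≤ |x|}, (1 / ε₁) * (a x * w x ^ 2)
      ≤ ∫ x, (1 / ε₁) * (a x * w x ^ 2) :=
    setIntegral_le_integral i3 (Filter.Eventually.of_forall fun x =>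
      mul_nonneg (one_div_pos.2 hε).le (mul_nonneg (ha0 x) (sq_nonneg _)))
  linarith

lemma V_le {V : ℝ → ℝ} (hV : ContDiff ℝ 1 V) (hV2 : ∀ x, deriv V x * x ≤ 0) (x : ℝ) :
    V x ≤ V 0 := by
  have hd := hV.differentiable one_ne_zero
  rcases le_total 0 x with hx | hx
  · have : AntitoneOn V (Set.Ici 0) := by
      apply antitoneOn_of_deriv_nonpos (convex_Ici 0) hV.continuous.continuousOn
        hd.differentiableOn
      intro y hy
      rw [interior_Ici, Set.mem_Ioi] at hy
      have := hV2 y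
      by_contra hc
      nlinarith
    exact this Set.self_mem_Ici hx hx
  · have : MonotoneOn V (Set.Iic 0) := by
      apply monotoneOn_of_deriv_nonneg (convex_Iic 0) hV.continuous.continuousOn
        hd.differentiableOn
      intro y hy
      rw [interior_Iic, Set.mem_Iio] at hy
      have := hV2 y
      by_contra hc
      nlinarith
    exact this hx Set.self_mem_Iic hx

section core2
variable {V a : ℝ → ℝ} {u p q m s r : ℝ → ℝ → ℝ} {T R : ℝ}

lemma mult_h_bd (S : SolData V a u p q m s r T R) (hV : ContDiff ℝ 1 V) (ha : Continuous a)
    {L ε₁ Cstar M : ℝ} (hL : 0 < L) (hLR : L ≤ R) (hε : 0 < ε₁) (hC : 0 < Cstar)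
    (hM : ∀ x, a x ≤ M) (hVp : ∀ x, 0 < V x)
    (ha0 : ∀ x, 0 ≤ a x) (hae : ∀ x : ℝ, L ≤ |x| → ε₁ ≤ a x)
    (hV2 : ∀ x, deriv V x * x ≤ 0)
    (hP : ∀ w : ℝ → ℝ, ContDiff ℝ 1 w →
      Integrable (fun x => w x ^ 2) → Integrable (fun x => deriv w x ^ 2) →
      ∫ x in {x : ℝ | |x| ≤ L}, w x ^ 2 ≤
        Cstar * ((∫ x, deriv w x ^ 2) + ∫ x in {x : ℝ | L ≤ |x|}, w x ^ 2))
    (hV0 : V 0 < 1 / (4 * Cstar)) {t : ℝ} (ht : t ∈ Set.Ioc 0 T) :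
    (∫ x in -R..R, (hh L x * (m t x * p t x + q t x * s t x)
      + (1 / 4) * (p t x ^ 2 + u t x * s t x + a x * (u t x * p t x))))
    ≤ - (1 / 16) * (∫ x in -R..R, (p t x ^ 2 + q t x ^ 2 + V x * u t x ^ 2))
      + (1 / ε₁ + 4 * M * L ^ 2) * ((∫ x in -R..R, a x * p t x ^ 2)
        + ∫ x in -R..R, a x * u t x ^ 2) := by
  rw [mult_h_id S hV ha hL hLR ht]
  obtain ⟨cu, cp, cq, cm, cs, cr, u_t, p_t, q_t, u_x, p_x, q_x, pde, u_van, q_van, p_van⟩ := S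
  have cV := hV.continuous
  have cV' : Continuous (deriv V) := hV.continuous_deriv le_rfl
  have chh := hh_cont L
  have ht' : t ∈ Set.Icc 0 T := ⟨ht.1.le, ht.2⟩
  have hRR : -R ≤ R := by linarith
  have hM0 : 0 ≤ M := (ha0 0).trans (hM 0)
  have hpo := poincare_int ha hL hε hC ha0 hae hP (u_x t) (by fun_prop) (u_van t ht') (q_van t ht')
  have hout := out_bd ha (by fun_prop : Continuous (p t)) hL hLR hε ha0 hae
  have hin : (1 / 2) * (∫ x in -L..L, p t x ^ 2) - (1 / 2 * V 0) * (∫ x in -L..L, u t x ^ 2)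
      ≤ ∫ x in -L..L, (1 / 2) * (p t x ^ 2 + q t x ^ 2 - V x * u t x ^ 2) := by
    rw [← intervalIntegral.integral_const_mul, ← intervalIntegral.integral_const_mul,
      ← intervalIntegral.integral_sub (Continuous.intervalIntegrable (by fun_prop) _ _)
      (Continuous.intervalIntegrable (by fun_prop) _ _)]
    apply intervalIntegral.integral_mono_on (by linarith)
      (Continuous.intervalIntegrable (by fun_prop) _ _)
      (Continuous.intervalIntegrable (by fun_prop) _ _)
    intro x _
    have := mul_le_mul_of_nonneg_right (V_le hV hV2 x) (sq_nonneg (u t x))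
    nlinarith [sq_nonneg (q t x)]
  have hfull : (∫ x in -R..R, ((1 / 2) * (deriv V x * hh L x) * u t x ^ 2
        - a x * hh L x * q t x * p t x
        + (1 / 4) * (p t x ^ 2 - q t x ^ 2 - V x * u t x ^ 2)))
      ≤ (1 / 4) * (∫ x in -R..R, p t x ^ 2) - (3 / 16) * (∫ x in -R..R, q t x ^ 2)
        - (1 / 4) * (∫ x in -R..R, V x * u t x ^ 2)
        + 4 * M * L ^ 2 * (∫ x in -R..R, a x * p t x ^ 2) := by
    rw [← intervalIntegral.integral_const_mul, ← intervalIntegral.integral_const_mul,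
      ← intervalIntegral.integral_const_mul, ← intervalIntegral.integral_const_mul,
      ← intervalIntegral.integral_sub (Continuous.intervalIntegrable (by fun_prop) _ _)
      (Continuous.intervalIntegrable (by fun_prop) _ _),
      ← intervalIntegral.integral_sub (Continuous.intervalIntegrable (by fun_prop) _ _)
      (Continuous.intervalIntegrable (by fun_prop) _ _),
      ← intervalIntegral.integral_add (Continuous.intervalIntegrable (by fun_prop) _ _)
      (Continuous.intervalIntegrable (by fun_prop) _ _)]
    apply intervalIntegral.integral_mono_on hRR
      (Continuous.intervalIntegrable (by fun_prop) _ _)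
      (Continuous.intervalIntegrable (by fun_prop) _ _)
    intro x _
    have h1 : (deriv V x * hh L x) * u t x ^ 2 ≤ 0 :=
      mul_nonpos_of_nonpos_of_nonneg (hh_mul hL hV2 x) (sq_nonneg _)
    have h2 : hh L x ^ 2 ≤ L ^ 2 := by
      rw [← sq_abs]; exact pow_le_pow_left₀ (abs_nonneg _) (hh_bd hL x) 2
    have h3 : a x * a x * hh L x ^ 2 ≤ M * a x * L ^ 2 := by
      apply mul_le_mul _ h2 (sq_nonneg _) (mul_nonneg hM0 (ha0 x))
      exact mul_le_mul_of_nonneg_right (hM x) (ha0 x)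
    have h4 := mul_le_mul_of_nonneg_right h3 (sq_nonneg (p t x))
    have h5 : 0 ≤ (q t x / 4 + 2 * (a x * hh L x * p t x)) ^ 2 := sq_nonneg _
    nlinarith
  have hsplit : (∫ x in -R..R, (p t x ^ 2 + q t x ^ 2 + V x * u t x ^ 2))
      = (∫ x in -R..R, p t x ^ 2) + (∫ x in -R..R, q t x ^ 2)
        + ∫ x in -R..R, V x * u t x ^ 2 := by
    rw [intervalIntegral.integral_add (Continuous.intervalIntegrable (by fun_prop) _ _)
      (Continuous.intervalIntegrable (by fun_prop) _ _),
      intervalIntegral.integral_add (Continuous.intervalIntegrable (by fun_prop) _ _)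
      (Continuous.intervalIntegrable (by fun_prop) _ _)]
  rw [hsplit]
  have hA : 0 ≤ ∫ x in -R..R, p t x ^ 2 :=
    intervalIntegral.integral_nonneg hRR fun x _ => sq_nonneg _
  have hD : 0 ≤ ∫ x in -R..R, V x * u t x ^ 2 :=
    intervalIntegral.integral_nonneg hRR fun x _ => mul_nonneg (hVp x).le (sq_nonneg _)
  have hPp : 0 ≤ ∫ x in -R..R, a x * p t x ^ 2 :=
    intervalIntegral.integral_nonneg hRR fun x _ => mul_nonneg (ha0 x) (sq_nonneg _)
  have hQ : 0 ≤ ∫ x in -R..R, a x * u t x ^ 2 :=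
    intervalIntegral.integral_nonneg hRR fun x _ => mul_nonneg (ha0 x) (sq_nonneg _)
  have hB : 0 ≤ ∫ x in -R..R, q t x ^ 2 :=
    intervalIntegral.integral_nonneg hRR fun x _ => sq_nonneg _
  generalize (∫ x in -R..R, p t x ^ 2) = A at *
  generalize (∫ x in -R..R, q t x ^ 2) = B at *
  generalize (∫ x in -R..R, V x * u t x ^ 2) = D at *
  generalize (∫ x in -R..R, a x * p t x ^ 2) = P at *
  generalize (∫ x in -R..R, a x * u t x ^ 2) = Q at *
  have hVC : V 0 * Cstar ≤ 1 / 4 := by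
    rw [lt_div_iff₀ (by positivity)] at hV0; nlinarith
  have hZ : 0 ≤ B + 1 / ε₁ * Q := by positivity
  have h7 := mul_le_mul_of_nonneg_left hpo (hVp 0).le
  have h8 := mul_le_mul_of_nonneg_right hVC hZ
  have h9 : 0 ≤ 1 / ε₁ * P := by positivity
  have h10 : 0 ≤ 1 / ε₁ * Q := by positivity
  have h11 : 0 ≤ 4 * M * L ^ 2 * Q := by positivity
  nlinarith

lemma core_bound (S : SolData V a u p q m s r T R) (hV : ContDiff ℝ 1 V) (ha : Continuous a)
    {L ε₁ Cstar M : ℝ} (hL : 0 < L) (hLR : L ≤ R) (hε : 0 < ε₁) (hC : 0 < Cstar)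
    (hM : ∀ x, a x ≤ M) (hVp : ∀ x, 0 < V x) (hT : 0 ≤ T)
    (ha0 : ∀ x, 0 ≤ a x) (hae : ∀ x : ℝ, L ≤ |x| → ε₁ ≤ a x)
    (hV2 : ∀ x, deriv V x * x ≤ 0)
    (hP : ∀ w : ℝ → ℝ, ContDiff ℝ 1 w →
      Integrable (fun x => w x ^ 2) → Integrable (fun x => deriv w x ^ 2) →
      ∫ x in {x : ℝ | |x| ≤ L}, w x ^ 2 ≤
        Cstar * ((∫ x, deriv w x ^ 2) + ∫ x in {x : ℝ | L ≤ |x|}, w x ^ 2))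
    (hV0 : V 0 < 1 / (4 * Cstar)) :
    (1 + T) * (∫ x in -R..R, (p T x ^ 2 + q T x ^ 2 + V x * u T x ^ 2))
      ≤ (1 + 16 * ((1 / ε₁ + 4 * M * L ^ 2) + 2 * (L / 2 + 1 / 8) + 2 * ((1 + M) / 8))) *
        ((∫ x in -R..R, (p 0 x ^ 2 + q 0 x ^ 2 + V x * u 0 x ^ 2))
          + (∫ x in -R..R, u 0 x ^ 2) + ∫ x in -R..R, (p 0 x + a x * u 0 x) ^ 2 / V x) := by
  have hR : 0 < R := by linarith
  have hRR : -R ≤ R := by linarith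
  have cV := hV.continuous
  have hM0 : 0 ≤ M := (ha0 0).trans (hM 0)
  have chh := hh_cont L
  have hen := fun {c d} h1 h2 h3 => energy_id S cV ha hR (c := c) (d := d) h1 h2 h3
  have hmv := mult_v S cV ha hVp hR hT
  have hmh := fun {t} ht => mult_h_bd S hV ha hL hLR hε hC hM hVp ha0 hae hV2 hP hV0 (t := t) ht
  obtain ⟨cu, cp, cq, cm, cs, cr, u_t, p_t, q_t, u_x, p_x, q_x, pde, u_van, q_van, p_van⟩ := S
  have key := TS (g := fun t x => hh L x * (q t x * p t x)
      + (1 / 4) * (u t x * p t x + a x * ((1 / 2) * u t x ^ 2)))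
    (g' := fun t x => hh L x * (m t x * p t x + q t x * s t x)
      + (1 / 4) * (p t x ^ 2 + u t x * s t x + a x * (u t x * p t x)))
    ?_ (by fun_prop) (by intro t; fun_prop) 0 T R hR
  swap
  · intro t x
    have := (((q_t t x).mul (p_t t x)).const_mul (hh L x)).add
      ((((u_t t x).mul (p_t t x)).add
        ((((u_t t x).pow 2).const_mul (1 / 2)).const_mul (a x))).const_mul (1 / 4))
    exact this.congr_deriv (by
      simp only [Nat.cast_ofNat, Nat.add_one_sub_one, pow_one]; ring)
  -- time-continuity
  have hct : ∀ g : ℝ → ℝ → ℝ, Continuous (Function.uncurry g) →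
      Continuous fun t => ∫ x in -R..R, g t x := fun g hg =>
    intervalIntegral.continuous_parametric_intervalIntegral_of_continuous' hg _ _
  set e : ℝ → ℝ := fun t => ∫ x in -R..R, (p t x ^ 2 + q t x ^ 2 + V x * u t x ^ 2) with he
  set P : ℝ → ℝ := fun t => ∫ x in -R..R, a x * p t x ^ 2 with hPd
  set Q : ℝ → ℝ := fun t => ∫ x in -R..R, a x * u t x ^ 2 with hQd
  have ce : Continuous e := hct _ (by fun_prop)
  have cP : Continuous P := hct _ (by fun_prop)
  have cQ : Continuous Q := hct _ (by fun_prop)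
  have P0 : ∀ t, 0 ≤ P t := fun t =>
    intervalIntegral.integral_nonneg hRR fun x _ => mul_nonneg (ha0 x) (sq_nonneg _)
  have Q0 : ∀ t, 0 ≤ Q t := fun t =>
    intervalIntegral.integral_nonneg hRR fun x _ => mul_nonneg (ha0 x) (sq_nonneg _)
  have e0 : ∀ t, 0 ≤ e t := fun t =>
    intervalIntegral.integral_nonneg hRR fun x _ => by
      have := mul_nonneg (hVp x).le (sq_nonneg (u t x)); positivity
  have hdec : ∀ t ∈ Set.Icc 0 T, e T ≤ e t := by
    intro t ht
    have h1 : e T - e t = -2 * ∫ y in t..T, P y := hen ht.1 ht.2 le_rfl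
    have h2 : 0 ≤ ∫ y in t..T, P y := intervalIntegral.integral_nonneg ht.2 fun y _ => P0 y
    linarith
  have hTe : T * e T ≤ ∫ t in 0..T, e t := by
    have : ∫ t in 0..T, e T ≤ ∫ t in 0..T, e t :=
      intervalIntegral.integral_mono_on hT (by simp) (ce.intervalIntegrable _ _) hdec
    simpa using this
  have hmono : (∫ t in 0..T, ∫ x in -R..R, (hh L x * (m t x * p t x + q t x * s t x)
      + (1 / 4) * (p t x ^ 2 + u t x * s t x + a x * (u t x * p t x))))
      ≤ - (1 / 16) * (∫ t in 0..T, e t)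
        + (1 / ε₁ + 4 * M * L ^ 2) * ((∫ t in 0..T, P t) + ∫ t in 0..T, Q t) := by
    rw [← intervalIntegral.integral_add (cP.intervalIntegrable _ _) (cQ.intervalIntegrable _ _),
      ← intervalIntegral.integral_const_mul, ← intervalIntegral.integral_const_mul,
      ← intervalIntegral.integral_add (Continuous.intervalIntegrable (by fun_prop) _ _)
      (Continuous.intervalIntegrable (by fun_prop) _ _)]
    apply intervalIntegral.integral_mono_on_of_le_Ioo hT
      (Continuous.intervalIntegrable (hct _ (by fun_prop)) _ _)
      (Continuous.intervalIntegrable (by fun_prop) _ _)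
    intro t ht
    exact hmh ⟨ht.1, ht.2.le⟩
  have hG : ∀ t, |∫ x in -R..R, (hh L x * (q t x * p t x)
      + (1 / 4) * (u t x * p t x + a x * ((1 / 2) * u t x ^ 2)))|
      ≤ (L / 2 + 1 / 8) * e t + (1 + M) / 8 * ∫ x in -R..R, u t x ^ 2 := by
    intro t
    refine (intervalIntegral.abs_integral_le_integral_abs hRR).trans ?_
    simp only [he]
    rw [← intervalIntegral.integral_const_mul, ← intervalIntegral.integral_const_mul,
      ← intervalIntegral.integral_add (Continuous.intervalIntegrable (by fun_prop) _ _)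
      (Continuous.intervalIntegrable (by fun_prop) _ _)]
    apply intervalIntegral.integral_mono_on hRR
      (Continuous.intervalIntegrable (by fun_prop) _ _)
      (Continuous.intervalIntegrable (by fun_prop) _ _)
    intro x _
    have b1 : |hh L x * (q t x * p t x)| ≤ L * ((q t x ^ 2 + p t x ^ 2) / 2) := by
      rw [abs_mul]
      apply mul_le_mul (hh_bd hL x) _ (abs_nonneg _) hL.le
      rw [abs_le]; constructor <;> nlinarith [sq_nonneg (q t x + p t x), sq_nonneg (q t x - p t x)]
    have b2 : |u t x * p t x| ≤ (u t x ^ 2 + p t x ^ 2) / 2 := by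
      rw [abs_le]; constructor <;> nlinarith [sq_nonneg (u t x + p t x), sq_nonneg (u t x - p t x)]
    have b3 : a x * u t x ^ 2 ≤ M * u t x ^ 2 :=
      mul_le_mul_of_nonneg_right (hM x) (sq_nonneg _)
    have b4 : 0 ≤ a x * u t x ^ 2 := mul_nonneg (ha0 x) (sq_nonneg _)
    have b5 : 0 ≤ V x * u t x ^ 2 := mul_nonneg (hVp x).le (sq_nonneg _)
    have b6 : 0 ≤ L * (V x * u t x ^ 2) := mul_nonneg hL.le b5
    have b7 := sq_nonneg (q t x)
    rw [abs_le] at b1 b2 ⊢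
    constructor <;> nlinarith [b1.1, b1.2, b2.1, b2.2]
  have hG0 := hG 0
  have hGT := hG T
  have hP' : e T - e 0 = -2 * ∫ t in 0..T, P t := hen le_rfl hT le_rfl
  have hdec0 := hdec 0 ⟨le_rfl, hT⟩
  have hIQ : 0 ≤ ∫ t in 0..T, Q t := intervalIntegral.integral_nonneg hT fun y _ => Q0 y
  have hF0 : 0 ≤ ∫ x in -R..R, (p 0 x + a x * u 0 x) ^ 2 / V x :=
    intervalIntegral.integral_nonneg hRR fun x _ => div_nonneg (sq_nonneg _) (hVp x).le
  have hN0 : 0 ≤ ∫ x in -R..R, u 0 x ^ 2 :=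
    intervalIntegral.integral_nonneg hRR fun x _ => sq_nonneg _
  have hNT : 0 ≤ ∫ x in -R..R, u T x ^ 2 :=
    intervalIntegral.integral_nonneg hRR fun x _ => sq_nonneg _
  have heT := e0 T
  have hK : 0 ≤ 1 / ε₁ + 4 * M * L ^ 2 := by positivity
  have hk1 : 0 ≤ L / 2 + 1 / 8 := by positivity
  have hk2 : 0 ≤ (1 + M) / 8 := by positivity
  show (1 + T) * e T ≤ _ * (e 0 + _ + _)
  rw [abs_le] at hG0 hGT
  have hg1 := hG0.2
  have hg2 := hGT.1
  clear hG0 hGT hG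
  generalize (∫ x in -R..R, (p 0 x + a x * u 0 x) ^ 2 / V x) = F0 at *
  generalize (∫ x in -R..R, u 0 x ^ 2) = N0 at *
  generalize (∫ x in -R..R, u T x ^ 2) = NT at *
  generalize (∫ t in 0..T, Q t) = IQ at *
  generalize (∫ t in 0..T, P t) = IP at *
  generalize 1 / ε₁ + 4 * M * L ^ 2 = K at *
  generalize L / 2 + 1 / 8 = k1 at *
  generalize (1 + M) / 8 = k2 at *
  generalize e T = eT at *
  generalize e 0 = e00 at *
  have s1 : K * (IP + IQ) ≤ K * (e00 + N0 + F0) := mul_le_mul_of_nonneg_left (by linarith) hK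
  have s2 : k1 * e00 ≤ k1 * (e00 + N0 + F0) := mul_le_mul_of_nonneg_left (by linarith) hk1
  have s3 : k1 * eT ≤ k1 * (e00 + N0 + F0) := mul_le_mul_of_nonneg_left (by linarith) hk1
  have s4 : k2 * N0 ≤ k2 * (e00 + N0 + F0) := mul_le_mul_of_nonneg_left (by linarith) hk2
  have s5 : k2 * NT ≤ k2 * (e00 + N0 + F0) := mul_le_mul_of_nonneg_left (by linarith) hk2
  linarith

end core2

lemma data_le {g : ℝ → ℝ} (hg : Integrable g) (h0 : ∀ x, 0 ≤ g x) {R : ℝ} (hR : 0 < R) :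
    ∫ x in -R..R, g x ≤ ∫ x, g x := by
  rw [intervalIntegral.integral_of_le (by linarith)]
  exact setIntegral_le_integral hg (Filter.Eventually.of_forall h0)

/-- **Proposition 2.2 (local energy decay).** Under (A.1), (A.2), (V.1), (V.2), a
Poincaré-type constant `C*`, and `0 < V(0) < 1/(4C*)`, there is a constant
`C > 0` such that every smooth classical solution with smooth compactly supported
data `(u₀, u₁)` satisfies `(1+t) ∫_{|x| ≤ L} u(t,x)² dx ≤ C I₀²` for all `t ≥ 0`. -/
theorem proposition_2_2
    (a V : ℝ → ℝ) (L ε₁ Cstar : ℝ)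
    (hL : 0 < L) (hε₁ : 0 < ε₁) (hCstar : 0 < Cstar)
    (ha_cont : Continuous a) (ha_bdd : ∃ M, ∀ x, |a x| ≤ M) (ha_nonneg : ∀ x, 0 ≤ a x)
    (ha_eff : ∀ x : ℝ, L ≤ |x| → ε₁ ≤ a x)
    (hV : ContDiff ℝ 1 V) (hV_bdd : ∃ M, ∀ x, |V x| ≤ M)
    (hV'_bdd : ∃ M, ∀ x, |deriv V x| ≤ M) (hV_pos : ∀ x, 0 < V x)
    (hV2 : ∀ x, deriv V x * x ≤ 0)
    (hP : ∀ w : ℝ → ℝ, ContDiff ℝ 1 w →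
      Integrable (fun x => w x ^ 2) → Integrable (fun x => deriv w x ^ 2) →
      ∫ x in {x : ℝ | |x| ≤ L}, w x ^ 2 ≤
        Cstar * ((∫ x, deriv w x ^ 2) + ∫ x in {x : ℝ | L ≤ |x|}, w x ^ 2))
    (hV0 : V 0 < 1 / (4 * Cstar)) :
    ∃ C > (0:ℝ), ∀ (u : ℝ → ℝ → ℝ) (u₀ u₁ : ℝ → ℝ),
      IsSmoothSolution V a u u₀ u₁ →
      ∀ t ≥ (0:ℝ),
        (1 + t) * (∫ x in {x : ℝ | |x| ≤ L}, (u t x) ^ 2) ≤ C * (I0 a V u₀ u₁) ^ 2 := by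
  obtain ⟨M, hM⟩ := ha_bdd
  have hM' : ∀ x, a x ≤ M := fun x => (le_abs_self _).trans (hM x)
  have hM0 : 0 ≤ M := (ha_nonneg 0).trans (hM' 0)
  have cV := hV.continuous
  obtain ⟨x₀, -, hx₀⟩ := (isCompact_Icc (a := -L) (b := L)).exists_isMinOn
    ⟨0, by constructor <;> linarith⟩ cV.continuousOn
  set C1 := (1 + 16 * ((1 / ε₁ + 4 * M * L ^ 2) + 2 * (L / 2 + 1 / 8) + 2 * ((1 + M) / 8)))
    with hC1
  have hC1p : 0 < C1 := by positivity
  have hv0 := hV_pos x₀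
  have hV00 := hV_pos 0
  refine ⟨(1 / V x₀) * (C1 * (2 + V 0)), by positivity, ?_⟩
  intro u u₀ u₁ hsol t ht
  obtain ⟨R, hLR, hR, S⟩ := solData_of hsol t ht L
  obtain ⟨hu, -, h0, h1, su0, ku0, su1, ku1, -⟩ := hsol
  have hb := core_bound S hV ha_cont hL hLR hε₁ hCstar hM' hV_pos ht ha_nonneg ha_eff hV2 hP hV0
  have hq0 : ∀ x, ux u 0 x = deriv u₀ x := fun x => by
    unfold ux; congr 1; ext y; exact h0 y
  simp only [h0, h1, hq0] at hb
  rw [← hC1] at hb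
  have cu0 := su0.continuous
  have cu1 := su1.continuous
  have cd0 : Continuous (deriv u₀) := su0.continuous_deriv (by simp)
  have cu := S.cu
  have cp := S.cp
  have cq := S.cq
  have hRR : -R ≤ R := by linarith
  rw [setInt_eq _ hL]
  -- lower bound
  have hlow : V x₀ * (∫ x in -L..L, u t x ^ 2)
      ≤ ∫ x in -R..R, (ut u t x ^ 2 + ux u t x ^ 2 + V x * u t x ^ 2) := by
    have l1 : V x₀ * (∫ x in -L..L, u t x ^ 2)
        ≤ ∫ x in -L..L, (ut u t x ^ 2 + ux u t x ^ 2 + V x * u t x ^ 2) := by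
      rw [← intervalIntegral.integral_const_mul]
      apply intervalIntegral.integral_mono_on (by linarith)
        (Continuous.intervalIntegrable (by fun_prop) _ _)
        (Continuous.intervalIntegrable (by fun_prop) _ _)
      intro x hx
      have := mul_le_mul_of_nonneg_right (hx₀ hx : V x₀ ≤ V x) (sq_nonneg (u t x))
      nlinarith [sq_nonneg (ut u t x), sq_nonneg (ux u t x)]
    refine l1.trans ?_
    apply intervalIntegral.integral_mono_interval (by linarith) (by linarith) hLR
    · refine Filter.Eventually.of_forall fun x => ?_
      have := mul_nonneg (hV_pos x).le (sq_nonneg (u t x))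
      show 0 ≤ ut u t x ^ 2 + ux u t x ^ 2 + V x * u t x ^ 2
      positivity
    · exact Continuous.intervalIntegrable (by fun_prop) _ _
  -- data
  have cs0 : ∀ g : ℝ → ℝ, Continuous g → HasCompactSupport g → Integrable g := fun g hg hk =>
    hg.integrable_of_hasCompactSupport hk
  have i0 : Integrable (fun x => u₀ x ^ 2) :=
    cs0 _ (by fun_prop) (ku0.comp_left (g := fun y : ℝ => y ^ 2) (by simp))
  have i1 : Integrable (fun x => u₁ x ^ 2) :=
    cs0 _ (by fun_prop) (ku1.comp_left (g := fun y : ℝ => y ^ 2) (by simp))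
  have i2 : Integrable (fun x => deriv u₀ x ^ 2) :=
    cs0 _ (by fun_prop) (ku0.deriv.comp_left (g := fun y : ℝ => y ^ 2) (by simp))
  have i3 : Integrable (fun x => (u₁ x + a x * u₀ x) ^ 2 / V x) := by
    apply cs0
    · exact Continuous.div (by fun_prop) cV fun x => (hV_pos x).ne'
    · have hk : HasCompactSupport fun x => u₁ x + a x * u₀ x := ku1.add ku0.mul_left
      refine hk.mono ?_
      intro x hx hx'
      apply hx
      simp only at hx'
      simp [hx']
  have d0 := data_le i0 (fun x => sq_nonneg _) hR
  have d1 := data_le i1 (fun x => sq_nonneg _) hR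
  have d2 := data_le i2 (fun x => sq_nonneg _) hR
  have d3 := data_le i3 (fun x => div_nonneg (sq_nonneg _) (hV_pos x).le) hR
  have n0 : 0 ≤ ∫ x, u₀ x ^ 2 := integral_nonneg fun x => sq_nonneg _
  have n1 : 0 ≤ ∫ x, u₁ x ^ 2 := integral_nonneg fun x => sq_nonneg _
  have n2 : 0 ≤ ∫ x, deriv u₀ x ^ 2 := integral_nonneg fun x => sq_nonneg _
  have n3 : 0 ≤ ∫ x, (u₁ x + a x * u₀ x) ^ 2 / V x :=
    integral_nonneg fun x => div_nonneg (sq_nonneg _) (hV_pos x).le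
  have hI : (∫ x, u₀ x ^ 2) + (∫ x, deriv u₀ x ^ 2) + (∫ x, u₁ x ^ 2)
      + (∫ x, (u₁ x + a x * u₀ x) ^ 2 / V x) ≤ I0 a V u₀ u₁ ^ 2 := by
    unfold I0
    have q1 := Real.sq_sqrt (add_nonneg n0 n2)
    have q2 := Real.sq_sqrt n1
    have q3 := Real.sq_sqrt n3
    have r1 := Real.sqrt_nonneg ((∫ x, u₀ x ^ 2) + ∫ x, deriv u₀ x ^ 2)
    have r2 := Real.sqrt_nonneg (∫ x, u₁ x ^ 2)
    have r3 := Real.sqrt_nonneg (∫ x, (u₁ x + a x * u₀ x) ^ 2 / V x)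
    nlinarith [mul_nonneg r1 r2, mul_nonneg r1 r3, mul_nonneg r2 r3]
  have he0 : (∫ x in -R..R, (u₁ x ^ 2 + deriv u₀ x ^ 2 + V x * u₀ x ^ 2))
      ≤ (∫ x in -R..R, u₁ x ^ 2) + (∫ x in -R..R, deriv u₀ x ^ 2)
        + V 0 * ∫ x in -R..R, u₀ x ^ 2 := by
    rw [← intervalIntegral.integral_const_mul,
      ← intervalIntegral.integral_add (Continuous.intervalIntegrable (by fun_prop) _ _)
      (Continuous.intervalIntegrable (by fun_prop) _ _),
      ← intervalIntegral.integral_add (Continuous.intervalIntegrable (by fun_prop) _ _)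
      (Continuous.intervalIntegrable (by fun_prop) _ _)]
    apply intervalIntegral.integral_mono_on hRR
      (Continuous.intervalIntegrable (by fun_prop) _ _)
      (Continuous.intervalIntegrable (by fun_prop) _ _)
    intro x _
    have := mul_le_mul_of_nonneg_right (V_le hV hV2 x) (sq_nonneg (u₀ x))
    linarith
  have hsum : (∫ x in -R..R, (u₁ x ^ 2 + deriv u₀ x ^ 2 + V x * u₀ x ^ 2))
      + (∫ x in -R..R, u₀ x ^ 2) + (∫ x in -R..R, (u₁ x + a x * u₀ x) ^ 2 / V x)
      ≤ (2 + V 0) * I0 a V u₀ u₁ ^ 2 := by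
    have z1 := mul_le_mul_of_nonneg_left d0 hV00.le
    have z2 := mul_le_mul_of_nonneg_left hI (by linarith : (0:ℝ) ≤ 2 + V 0)
    have z3 := mul_nonneg hV00.le n1
    have z4 := mul_nonneg hV00.le n2
    have z5 := mul_nonneg hV00.le n3
    linarith
  have f1 := mul_le_mul_of_nonneg_left hsum hC1p.le
  have f2 := mul_le_mul_of_nonneg_left hlow (by linarith : (0:ℝ) ≤ 1 + t)
  have f3 : V x₀ * ((1 + t) * ∫ x in -L..L, u t x ^ 2) ≤ C1 * ((2 + V 0) * I0 a V u₀ u₁ ^ 2) := by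
    linarith
  have f4 : (1 + t) * (∫ x in -L..L, u t x ^ 2) ≤ (C1 * ((2 + V 0) * I0 a V u₀ u₁ ^ 2)) / V x₀ := by
    rw [le_div_iff₀ hv0]; linarith
  calc _ ≤ _ := f4
    _ = _ := by ring
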